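/- There is a constant C > 0 such that every 3-program P with n atoms has at most C · 1.70711^n stable models (here 1.70711 denotes the rational number 170711/100000). -/

import Mathlib

/-- A clause of a propositional logic program: an optional head (a definite
clause if `head = some h`, a constraint if `head = none`), a positive body
and a negative body. -/
structure LPClause (α : Type) where
  head : Option α
  pos : Finset α
  neg : Finset α
deriving DecidableEq

/-- A program is a finite set of clauses. -/
abbrev LPProgram (α : Type) := Finset (LPClause α)

/-- The atoms occurring in a clause. -/
def LPClause.atoms {α : Type} [DecidableEq α] (c : LPClause α) : Finset α :=
  c.head.toFinset ∪ c.pos ∪ c.neg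

/-- The atoms occurring in a program. -/
def LPProgram.atoms {α : Type} [DecidableEq α] (P : LPProgram α) : Finset α :=
  P.sup LPClause.atoms

/-- `N` is closed under the Horn rules of the reduct `P^M`: for every definite
clause of `P` whose negative body is disjoint from `M`, if its positive body
is contained in `N` then so is its head. -/
def ClosedUnder {α : Type} (P : LPProgram α) (M : Finset α) (N : Set α) : Prop :=
  ∀ c ∈ P, ∀ h : α, c.head = some h → (∀ b ∈ c.neg, b ∉ M) →
    (↑c.pos : Set α) ⊆ N → h ∈ N

/-- `M` is a stable model of `P`: `M` is the least set closed under the rules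
of the reduct `P^M` (i.e. `M = lm(P^M)`), and `M` satisfies every constraint
of `P`. -/
def IsStable {α : Type} (P : LPProgram α) (M : Finset α) : Prop :=
  ClosedUnder P M ↑M ∧ (∀ N : Set α, ClosedUnder P M N → ↑M ⊆ N) ∧
  ∀ c ∈ P, c.head = none → ¬(c.pos ⊆ M ∧ ∀ b ∈ c.neg, b ∉ M)

/-- `P` is a `t`-program: every clause has at most `t` literals, counting the head. -/
def IsTProgram {α : Type} (P : LPProgram α) (t : ℕ) : Prop :=
  ∀ c ∈ P, c.pos.card + c.neg.card + (c.head.elim 0 fun _ => 1) ≤ t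

open Finset

/-- If memberships are decided one after another in the order given by `τ`, with subprobabilities
`p` (in) and `q` (out) depending only on strictly earlier decisions, the total mass is at most
one. -/
theorem sum_powerset_prod_le_one {α : Type*} [DecidableEq α] (τ : α → ℕ)
    (p q : α → Finset α → ℝ) (hp : ∀ a M, 0 ≤ p a M) (hq : ∀ a M, 0 ≤ q a M)
    (hpq : ∀ a M, p a M + q a M ≤ 1)
    (hloc : ∀ a M M', (∀ b, τ b < τ a → (b ∈ M ↔ b ∈ M')) → p a M = p a M' ∧ q a M = q a M')
    (s : Finset α) :
    ∑ M ∈ s.powerset, ∏ a ∈ s, (if a ∈ M then p a M else q a M) ≤ 1 := by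
  induction s using Finset.induction_on_max_value τ with
  | empty => simp
  | insert a s ha hmax ih =>
    rw [sum_powerset_insert ha, ← sum_add_distrib]
    refine (sum_le_sum fun M hM => ?_).trans ih
    have haM : a ∉ M := fun h => ha (mem_powerset.1 hM h)
    have hins : ∀ b, τ b ≤ τ a → p b (insert a M) = p b M ∧ q b (insert a M) = q b M := by
      intro b hb
      refine hloc _ _ _ fun c hc => ?_
      have : c ≠ a := by rintro rfl; omega
      simp [this]
    rw [prod_insert ha, prod_insert ha, if_neg haM, if_pos (mem_insert_self a M),
      (hins a le_rfl).1]
    have hprod : ∏ b ∈ s, (if b ∈ insert a M then p b (insert a M) else q b (insert a M)) =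
        ∏ b ∈ s, (if b ∈ M then p b M else q b M) := by
      refine prod_congr rfl fun b hb => ?_
      have hba : b ≠ a := ne_of_mem_of_not_mem hb ha
      rw [(hins b (hmax b hb)).1, (hins b (hmax b hb)).2]
      simp [hba]
    rw [hprod, ← add_mul]
    refine mul_le_of_le_one_left (prod_nonneg fun b _ => ?_) ?_
    · split_ifs
      exacts [hp _ _, hq _ _]
    · linarith [hpq a M]

theorem card_filter_eq_and_forall_lt {α : Type*} [Fintype α] [DecidableEq α] {L : ℕ}
    (hL : 0 < L) {a : α} {O : Finset α} (ha : a ∉ O) (i : Fin L) :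
    (#{τ : α → Fin L | τ a = i ∧ ∀ b ∈ O, τ b < i} : ℝ) =
      L ^ Fintype.card α * (1 / L * (i / L) ^ #O) := by
  have hset : ({τ : α → Fin L | τ a = i ∧ ∀ b ∈ O, τ b < i} : Finset (α → Fin L)) =
      Fintype.piFinset fun b => if b = a then {i} else if b ∈ O then Finset.Iio i else univ := by
    ext τ
    simp only [mem_filter, mem_univ, true_and, Fintype.mem_piFinset]
    constructor
    · rintro ⟨h1, h2⟩ b
      split_ifs with hb hb'
      · simp [hb, h1]
      · simpa using h2 b hb'
      · simp
    · intro h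
      refine ⟨by simpa using h a, fun b hb => ?_⟩
      have hba : b ≠ a := ne_of_mem_of_not_mem hb ha
      simpa [hba, hb] using h b
  have hL' : (L : ℝ) ≠ 0 := by positivity
  rw [hset, Fintype.card_piFinset]
  push_cast
  have hfac : ∀ b, ((#(if b = a then {i} else if b ∈ O then Finset.Iio i else univ) : ℕ) : ℝ) =
      L * ((if b = a then 1 / (L : ℝ) else 1) * if b ∈ O then (i / L : ℝ) else 1) := by
    intro b
    by_cases hb : b = a
    · subst hb; simp [ha, hL']
    · by_cases hb' : b ∈ O
      · simp [hb, hb', mul_div_cancel₀, hL']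
      · simp [hb, hb']
  simp_rw [hfac, prod_mul_distrib]
  simp only [prod_const, prod_ite_eq', prod_ite_mem, mem_univ, if_true, univ_inter, card_univ]

section Entropy

variable {α : Type*} [Fintype α] [DecidableEq α] {L : ℕ}

theorem sum_apply_eq (hL : 0 < L) (a : α) (f : Fin L → ℝ) :
    ∑ τ : α → Fin L, f (τ a) = L ^ Fintype.card α * ((∑ i, f i) / L) := by
  rw [← sum_fiberwise univ (fun τ : α → Fin L => τ a)]
  rw [sum_div, mul_sum]
  refine sum_congr rfl fun i _ => ?_
  have h := card_filter_eq_and_forall_lt hL (notMem_empty a) i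
  simp only [notMem_empty, false_imp_iff, implies_true, and_true, card_empty, pow_zero,
    mul_one] at h
  rw [sum_congr rfl (g := fun _ => f i) (by intro τ hτ; rw [(mem_filter.1 hτ).2]), sum_const,
    nsmul_eq_mul, h]
  ring

theorem sum_ite_forall_lt_le (hL : 0 < L) {a : α} {O : Finset α} (ha : a ∉ O) (hO : #O ≤ 2)
    (f : Fin L → ℝ) (hf : ∀ i, 0 ≤ f i) :
    ∑ τ : α → Fin L, (if ∀ b ∈ O, τ b < τ a then 0 else f (τ a)) ≤
      L ^ Fintype.card α * ((∑ i, f i * (L ^ 2 - i ^ 2)) / L ^ 3) := by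
  have hL' : (0 : ℝ) < L := by positivity
  have hsplit : ∑ τ : α → Fin L, (if ∀ b ∈ O, τ b < τ a then 0 else f (τ a)) =
      ∑ τ : α → Fin L, f (τ a) -
        ∑ τ : α → Fin L, (if ∀ b ∈ O, τ b < τ a then f (τ a) else 0) := by
    rw [← sum_sub_distrib]
    refine sum_congr rfl fun τ _ => ?_
    split_ifs <;> simp
  have hearly : ∑ τ : α → Fin L, (if ∀ b ∈ O, τ b < τ a then f (τ a) else 0) =
      ∑ i, f i * (L ^ Fintype.card α * (1 / L * (i / L) ^ #O)) := by
    rw [← sum_fiberwise univ (fun τ : α → Fin L => τ a)]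
    refine sum_congr rfl fun i _ => ?_
    rw [← card_filter_eq_and_forall_lt hL ha i, ← sum_filter, filter_filter,
      sum_congr (s₂ := {τ : α → Fin L | τ a = i ∧ ∀ b ∈ O, τ b < i}) (g := fun _ => f i),
      sum_const, nsmul_eq_mul, mul_comm]
    · ext τ
      simp only [mem_filter, mem_univ, true_and]
      exact and_congr_right fun h => by rw [h]
    · intro τ hτ
      rw [(mem_filter.1 hτ).2.1]
  rw [hsplit, hearly, sum_apply_eq hL, sum_div, sum_div, mul_sum, mul_sum, ← sum_sub_distrib]
  refine sum_le_sum fun i _ => ?_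
  have hi : (i / L : ℝ) ^ 2 ≤ (i / L) ^ #O := by
    refine pow_le_pow_of_le_one (by positivity) ?_ hO
    rw [div_le_one hL']
    exact_mod_cast i.2.le
  have hmul := mul_le_mul_of_nonneg_left hi
    (show 0 ≤ f i * (L ^ Fintype.card α * (1 / L)) by have := hf i; positivity)
  have heq : (L : ℝ) ^ Fintype.card α * (f i * (L ^ 2 - i ^ 2) / L ^ 3) =
      L ^ Fintype.card α * (f i / L) -
        f i * (L ^ Fintype.card α * (1 / L)) * (i / L) ^ 2 := by
    field_simp
  rw [heq]
  linarith

/-- Among the members of `𝓜`, those agreeing with `M` on all elements earlier than `a` (in the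
order given by `τ`) contain `a`. -/
def IsForced (𝓜 : Finset (Finset α)) (τ : α → Fin L) (M : Finset α) (a : α) : Prop :=
  ∀ M' ∈ 𝓜, (∀ b, τ b < τ a → (b ∈ M' ↔ b ∈ M)) → a ∈ M'

open Classical in
/-- The number of symbols spent on `a` when the members of `𝓜` are encoded element by element in
the order given by `τ`: nothing if `a` is forced, and otherwise `t (τ a)` or `f (τ a)` according to
whether `a` belongs to `M`. -/
noncomputable def codeCost (𝓜 : Finset (Finset α)) (t f : Fin L → ℕ) (τ : α → Fin L)
    (M : Finset α) (a : α) : ℕ :=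
  if a ∈ M then if IsForced 𝓜 τ M a then 0 else t (τ a) else f (τ a)

theorem sum_pow_codeCost_le_one (𝓜 : Finset (Finset α)) (t f : Fin L → ℕ) (τ : α → Fin L)
    {y : ℝ} (hy : 0 < y) (hkraft : ∀ i, y ^ t i + y ^ f i ≤ 1) :
    ∑ M ∈ 𝓜, y ^ ∑ a, codeCost 𝓜 t f τ M a ≤ 1 := by
  classical
  have hloc : ∀ a M M', (∀ b, (τ b : ℕ) < τ a → (b ∈ M ↔ b ∈ M')) →
      (IsForced 𝓜 τ M a ↔ IsForced 𝓜 τ M' a) := by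
    intro a M M' h
    refine forall₂_congr fun N _ => imp_congr_left (forall₂_congr fun b hb => ?_)
    rw [h b hb]
  have key := sum_powerset_prod_le_one (fun a => (τ a : ℕ))
    (fun a M => if IsForced 𝓜 τ M a then 1 else y ^ t (τ a))
    (fun a M => if IsForced 𝓜 τ M a then 0 else y ^ f (τ a))
    (fun a M => by positivity) (fun a M => by positivity)
    (fun a M => by split_ifs <;> simp [hkraft])
    (fun a M M' h => by simp [hloc a M M' h]) univ
  refine le_trans ?_ key
  refine (sum_le_sum fun M hM => ?_).trans
    (sum_le_sum_of_subset_of_nonneg (fun M _ => by simp) fun M _ _ => ?_)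
  · rw [← prod_pow_eq_pow_sum]
    refine (prod_congr rfl fun a _ => ?_).le
    by_cases ha : a ∈ M
    · by_cases hf : IsForced 𝓜 τ M a <;> simp [codeCost, ha, hf]
    · have hf : ¬ IsForced 𝓜 τ M a := fun h => ha (h M hM fun _ _ => Iff.rfl)
      simp [codeCost, ha, hf]
  · exact prod_nonneg fun a _ => by positivity

/-- A weighted counting bound for families in which every membership `a ∈ M` is forced by the
trace of `M` on at most two further elements. -/
theorem card_mul_pow_le_one (𝓜 : Finset (Finset α))
    (h𝓜 : ∀ M ∈ 𝓜, ∀ a ∈ M, ∃ O : Finset α, a ∉ O ∧ #O ≤ 2 ∧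
      ∀ M' ∈ 𝓜, (∀ b ∈ O, b ∈ M' ↔ b ∈ M) → a ∈ M')
    (hL : 0 < L) (N : ℕ) (t f : Fin L → ℕ) {y : ℝ} (hy : 0 < y) (hy1 : y ≤ 1)
    (hkraft : ∀ i, y ^ t i + y ^ f i ≤ 1)
    (ht : ∑ i, (t i : ℝ) * (L ^ 2 - i ^ 2) ≤ N * L ^ 3) (hf : ∑ i, (f i : ℝ) ≤ N * L) :
    #𝓜 * y ^ (N * Fintype.card α) ≤ 1 := by
  classical
  set n := Fintype.card α with hn
  have hL' : (0 : ℝ) < L := by positivity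
  have hcost : ∀ M ∈ 𝓜, ∀ a, ∑ τ : α → Fin L, (codeCost 𝓜 t f τ M a : ℝ) ≤ L ^ n * N := by
    intro M hM a
    by_cases ha : a ∈ M
    · obtain ⟨O, haO, hO, hforce⟩ := h𝓜 M hM a ha
      calc ∑ τ : α → Fin L, (codeCost 𝓜 t f τ M a : ℝ)
          ≤ ∑ τ : α → Fin L, (if ∀ b ∈ O, τ b < τ a then 0 else (t (τ a) : ℝ)) := by
            refine sum_le_sum fun τ _ => ?_
            by_cases hτ : ∀ b ∈ O, τ b < τ a
            · have : IsForced 𝓜 τ M a :=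
                fun M' hM' h => hforce M' hM' fun b hb => h b (hτ b hb)
              simp only [codeCost, if_pos ha, if_pos this, if_pos hτ, Nat.cast_zero, le_refl]
            · rw [if_neg hτ, codeCost, if_pos ha]
              split_ifs <;> simp
        _ ≤ L ^ n * ((∑ i, (t i : ℝ) * (L ^ 2 - i ^ 2)) / L ^ 3) :=
            sum_ite_forall_lt_le hL haO hO (fun i => (t i : ℝ)) fun i => by positivity
        _ ≤ L ^ n * N := by
            gcongr
            rwa [div_le_iff₀ (by positivity)]
    · simp only [codeCost, if_neg ha]
      rw [sum_apply_eq hL a fun i => (f i : ℝ)]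
      gcongr
      rwa [div_le_iff₀ hL']
  have hlog : Real.log y ≤ 0 := Real.log_nonpos hy.le hy1
  have hmodel : ∀ M ∈ 𝓜, (L : ℝ) ^ n * y ^ (N * n) ≤
      ∑ τ : α → Fin L, y ^ ∑ a, codeCost 𝓜 t f τ M a := by
    intro M hM
    have htotal : ∑ τ : α → Fin L, ((∑ a, codeCost 𝓜 t f τ M a : ℕ) : ℝ) ≤ L ^ n * (N * n) := by
      push_cast
      rw [sum_comm]
      refine (sum_le_sum fun a _ => hcost M hM a).trans_eq ?_
      rw [sum_const, card_univ, ← hn, nsmul_eq_mul]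
      ring
    have htangent : ∀ k : ℕ, y ^ (N * n) * (1 + (k - N * n) * Real.log y) ≤ y ^ k := by
      intro k
      have h := Real.add_one_le_exp ((k - N * n) * Real.log y)
      have hexp : Real.exp ((k - N * n) * Real.log y) * y ^ (N * n) = y ^ k := by
        rw [← Real.exp_log hy, ← Real.exp_nat_mul, ← Real.exp_nat_mul, Real.log_exp,
          ← Real.exp_add]
        push_cast
        ring_nf
      rw [← hexp, mul_comm, add_comm]
      gcongr
    refine le_trans ?_ (sum_le_sum fun τ _ => htangent _)
    rw [← mul_sum, sum_add_distrib, ← sum_mul, sum_sub_distrib]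
    simp only [sum_const, card_univ, Fintype.card_fun, Fintype.card_fin, nsmul_eq_mul,
      mul_one, ← hn]
    push_cast at htotal ⊢
    rw [mul_comm]
    gcongr
    nlinarith
  have hsum : (L : ℝ) ^ n * (#𝓜 * y ^ (N * n)) ≤ L ^ n * 1 := by
    calc (L : ℝ) ^ n * (#𝓜 * y ^ (N * n)) = ∑ M ∈ 𝓜, (L : ℝ) ^ n * y ^ (N * n) := by
          rw [sum_const, nsmul_eq_mul]; ring
      _ ≤ ∑ M ∈ 𝓜, ∑ τ : α → Fin L, y ^ ∑ a, codeCost 𝓜 t f τ M a := sum_le_sum hmodel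
      _ = ∑ τ : α → Fin L, ∑ M ∈ 𝓜, y ^ ∑ a, codeCost 𝓜 t f τ M a := sum_comm
      _ ≤ ∑ τ : α → Fin L, 1 :=
          sum_le_sum fun τ _ => sum_pow_codeCost_le_one 𝓜 t f τ hy hkraft
      _ = L ^ n * 1 := by simp [hn]
  exact le_of_mul_le_mul_left hsum (by positivity)

end Entropy

/-- An entry `(s, t, f)` prescribes the code lengths `t` and `f` for the times below `s` that are
not covered by an earlier entry. -/
def codeTable : List (ℕ × ℕ × ℕ) :=
  [(1146, 6538, 7341), (1760, 7082, 6783), (2226, 7789, 6142), (2607, 8671, 5450),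
    (2927, 9762, 4728), (3199, 11118, 3989), (3430, 12821, 3250), (3627, 15007, 2523),
    (3792, 17911, 1825), (3927, 21977, 1178), (4030, 28238, 613), (4096, 40296, 180)]

/-- The code lengths (for membership and non-membership) used at time `i`. -/
def codeLengths (i : ℕ) : ℕ × ℕ :=
  ((codeTable.find? fun e => i < e.1).getD (4096, 40296, 180)).2

theorem codeTable_kraft : ∀ e ∈ codeTable,
    9999 ^ e.2.1 * 10000 ^ e.2.2 + 9999 ^ e.2.2 * 10000 ^ e.2.1 ≤ 10000 ^ (e.2.1 + e.2.2) := by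
  decide +kernel

theorem codeLengths_kraft (i : ℕ) :
    (9999 / 10000 : ℝ) ^ (codeLengths i).1 + (9999 / 10000) ^ (codeLengths i).2 ≤ 1 := by
  obtain ⟨e, he, hei⟩ : ∃ e ∈ codeTable, codeLengths i = e.2 := by
    unfold codeLengths
    cases h : codeTable.find? fun e => i < e.1 with
    | none => exact ⟨_, by simp [codeTable], rfl⟩
    | some e => exact ⟨e, List.mem_of_find?_eq_some h, rfl⟩
  rw [hei, div_pow, div_pow, div_add_div _ _ (by positivity) (by positivity),
    div_le_one (by positivity), ← pow_add, mul_comm (10000 ^ e.2.1) _]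
  exact_mod_cast codeTable_kraft e he

/-- The sum of `f` over the `2 ^ k` integers from `m` on, by repeated halving. -/
def dyadicSum (f : ℕ → ℕ) : ℕ → ℕ → ℕ
  | 0, m => f m
  | k + 1, m => dyadicSum f k m + dyadicSum f k (m + 2 ^ k)

theorem dyadicSum_eq (f : ℕ → ℕ) (k m : ℕ) :
    dyadicSum f k m = ∑ i ∈ range (2 ^ k), f (m + i) := by
  induction k generalizing m with
  | zero => simp [dyadicSum]
  | succ k ih =>
    rw [dyadicSum, ih, ih, pow_succ, mul_two, sum_range_add]
    simp only [add_assoc]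

theorem sum_codeLengths_snd : ∑ i ∈ range 4096, (codeLengths i).2 ≤ 5347 * 4096 := by
  have h : dyadicSum (fun i => (codeLengths i).2) 12 0 ≤ 5347 * 4096 := by decide +kernel
  simpa [dyadicSum_eq] using h

theorem sum_codeLengths_fst :
    ∑ i ∈ range 4096, (codeLengths i).1 * (4096 ^ 2 - i ^ 2) ≤ 5347 * 4096 ^ 3 := by
  have h : dyadicSum (fun i => (codeLengths i).1 * (4096 ^ 2 - i ^ 2)) 12 0 ≤
      5347 * 4096 ^ 3 := by decide +kernel
  simpa [dyadicSum_eq] using h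

theorem base_pow_le : (10000 / 9999 : ℝ) ^ 5347 ≤ 170711 / 100000 := by
  have h : 10000 ^ 5347 * 100000 ≤ 170711 * 9999 ^ 5347 := by decide +kernel
  rw [div_pow, div_le_div_iff₀ (by positivity) (by norm_num)]
  exact_mod_cast h

/-- A family of subsets of a finite type in which every membership `a ∈ M` is forced by the trace
of `M` on at most two further elements has at most `1.70711 ^ n` members. -/
theorem card_le_of_forced_by_two {α : Type*} [Fintype α] [DecidableEq α]
    (𝓜 : Finset (Finset α))
    (h𝓜 : ∀ M ∈ 𝓜, ∀ a ∈ M, ∃ O : Finset α, a ∉ O ∧ #O ≤ 2 ∧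
      ∀ M' ∈ 𝓜, (∀ b ∈ O, b ∈ M' ↔ b ∈ M) → a ∈ M') :
    (#𝓜 : ℝ) ≤ (170711 / 100000 : ℝ) ^ Fintype.card α := by
  have ht : ∑ i : Fin 4096, ((codeLengths i).1 : ℝ) * ((4096 : ℕ) ^ 2 - (i : ℕ) ^ 2) ≤
      (5347 : ℕ) * (4096 : ℕ) ^ 3 := by
    rw [Fin.sum_univ_eq_sum_range
      fun i => ((codeLengths i).1 : ℝ) * (((4096 : ℕ) : ℝ) ^ 2 - (i : ℝ) ^ 2)]
    have h : ((∑ i ∈ range 4096, (codeLengths i).1 * (4096 ^ 2 - i ^ 2) : ℕ) : ℝ) ≤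
        (5347 * 4096 ^ 3 : ℕ) := Nat.cast_le.2 sum_codeLengths_fst
    rw [Nat.cast_sum] at h
    refine (sum_congr rfl fun i hi => ?_).trans_le (h.trans_eq (by norm_num))
    have hi' : i ^ 2 ≤ 4096 ^ 2 := Nat.pow_le_pow_left (mem_range.1 hi).le 2
    rw [Nat.cast_mul, Nat.cast_sub hi', Nat.cast_pow, Nat.cast_pow]
  have hf : ∑ i : Fin 4096, ((codeLengths i).2 : ℝ) ≤ (5347 : ℕ) * (4096 : ℕ) := by
    rw [Fin.sum_univ_eq_sum_range fun i => ((codeLengths i).2 : ℝ)]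
    exact_mod_cast sum_codeLengths_snd
  have h := card_mul_pow_le_one 𝓜 h𝓜 (by norm_num) 5347
    (fun i : Fin 4096 => (codeLengths i).1) (fun i => (codeLengths i).2)
    (y := 9999 / 10000) (by norm_num) (by norm_num) (fun i => codeLengths_kraft i) ht hf
  rw [← le_div_iff₀ (by positivity)] at h
  refine h.trans ?_
  rw [one_div, ← inv_pow, inv_div, pow_mul]
  exact pow_le_pow_left₀ (by positivity) base_pow_le _

section Stable

variable {α : Type} [DecidableEq α] {P : LPProgram α} {M : Finset α}

theorem LPClause.atoms_subset {c : LPClause α} (hc : c ∈ P) : c.atoms ⊆ P.atoms :=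
  le_sup (f := LPClause.atoms) hc

theorem IsStable.subset_atoms (hM : IsStable P M) : M ⊆ P.atoms := by
  refine coe_subset.1 (hM.2.1 _ fun c hc h hh _ _ => LPClause.atoms_subset hc ?_)
  simp [LPClause.atoms, hh]

theorem IsStable.exists_support (hM : IsStable P M) {a : α} (ha : a ∈ M) :
    ∃ c ∈ P, c.head = some a ∧ a ∉ c.pos ∪ c.neg ∧ c.pos ⊆ M ∧ ∀ b ∈ c.neg, b ∉ M := by
  by_contra! hno
  have hclosed : ClosedUnder P M (↑M \ {a}) := by
    intro c hc h hh hneg hpos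
    refine ⟨hM.1 c hc h hh hneg (hpos.trans Set.sdiff_subset), ?_⟩
    rintro rfl
    obtain ⟨b, hb, hbM⟩ := hno c hc hh
      (by
        rw [mem_union, not_or]
        exact ⟨fun h' => (hpos h').2 rfl, fun h' => hneg _ h' ha⟩)
      fun b hb => (hpos hb).1
    exact hneg b hb hbM
  exact (hM.2.1 _ hclosed ha).2 rfl

end Stable

/-- There is a constant `C > 0` such that every 3-program with `n` atoms has
at most `C * 1.70711 ^ n` stable models. -/
theorem stmt_15 :
    ∃ C : ℝ, 0 < C ∧ ∀ (α : Type) [DecidableEq α] (P : LPProgram α),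
      IsTProgram P 3 →
      ({M : Finset α | IsStable P M}.ncard : ℝ) ≤
        C * (170711 / 100000 : ℝ) ^ P.atoms.card := by
  classical
  refine ⟨1, one_pos, fun α _ P hP => ?_⟩
  let emb : Finset P.atoms → Finset α := fun M => M.map (Function.Embedding.subtype _)
  let 𝓜 : Finset (Finset P.atoms) := {M | IsStable P (emb M)}
  have hmem : ∀ (M : Finset P.atoms) (b : α) (hb : b ∈ P.atoms), b ∈ emb M ↔ ⟨b, hb⟩ ∈ M := by
    intro M b hb
    simp [emb, hb]
  have hsub : {M : Finset α | IsStable P M} ⊆ emb '' (𝓜 : Set (Finset P.atoms)) := by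
    intro M hM
    have hM' : emb (M.subtype (· ∈ P.atoms)) = M :=
      subtype_map_of_mem fun a ha => IsStable.subset_atoms hM ha
    exact ⟨M.subtype (· ∈ P.atoms), by simpa [𝓜, hM'] using hM, hM'⟩
  have hcard : {M : Finset α | IsStable P M}.ncard ≤ #𝓜 := by
    refine (Set.ncard_le_ncard hsub (Set.toFinite _)).trans ?_
    exact (Set.ncard_image_le (Set.toFinite _)).trans_eq (Set.ncard_coe_finset 𝓜)
  have hbound := card_le_of_forced_by_two 𝓜 fun M hM a ha => by
    obtain ⟨c, hc, hhead, hac, hpos, hneg⟩ :=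
      IsStable.exists_support (mem_filter.1 hM).2 ((hmem M a a.2).2 ha)
    have hatoms : ∀ b ∈ c.pos ∪ c.neg, b ∈ P.atoms := fun b hb =>
      LPClause.atoms_subset hc (by simp_all [LPClause.atoms])
    refine ⟨(c.pos ∪ c.neg).subtype (· ∈ P.atoms), by simpa using hac, ?_, ?_⟩
    · have h3 := hP c hc
      rw [hhead] at h3
      simp only [Option.elim] at h3
      rw [card_subtype]
      have := card_filter_le (c.pos ∪ c.neg) (· ∈ P.atoms)
      have := card_union_le c.pos c.neg
      omega
    · intro M' hM' hagree
      have hagree' : ∀ b ∈ c.pos ∪ c.neg, (b ∈ emb M' ↔ b ∈ emb M) := fun b hb => by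
        rw [hmem M' b (hatoms b hb), hmem M b (hatoms b hb)]
        exact hagree _ (mem_subtype.2 hb)
      refine (hmem M' a a.2).1 ((mem_filter.1 hM').2.1 c hc a hhead (fun b hb => ?_) fun b hb => ?_)
      · rw [hagree' b (mem_union_right _ hb)]
        exact hneg b hb
      · exact (hagree' b (mem_union_left _ hb)).2 (hpos hb)
  rw [one_mul]
  rw [Fintype.card_coe] at hbound
  exact (Nat.cast_le.2 hcard).trans hbound
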